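/- For every compact, connected, oriented manifold M with boundary, the ideal simplicial volume is bounded above by the classical simplicial volume: ‖M‖_I ≤ ‖M‖. -/

import Mathlib

open scoped BigOperators
open Topology
noncomputable section

/-! ### Quasicones and marked spaces -/

/-- `B` is a *quasicone* with apex `b`: there is a homotopy `H` from the identity to the
constant map at `b` with `H ⁻¹' {b} = ({b} × I) ∪ (B × {1})`. -/
def IsQuasicone {B : Type*} [TopologicalSpace B] (b : B) : Prop :=
  ∃ H : C(B × unitInterval, B),
    (∀ x, H (x, 0) = x) ∧ (∀ x, H (x, 1) = b) ∧
    (∀ x t, H (x, t) = b ↔ x = b ∨ t = 1)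

/-- A *marked space* `(X, B)`: `B` is closed in `X` and every `b ∈ B` has a closed
quasiconical neighbourhood `F b` with apex `b`, the `F b` being pairwise disjoint. -/
structure IsMarkedSpace (X : Type*) [TopologicalSpace X] (B : Set X) : Prop where
  closed : IsClosed B
  quasicones : ∃ F : B → Set X,
    (∀ b : B, IsClosed (F b)) ∧ (∀ b : B, F b ∈ nhds (b : X)) ∧
    (∀ b b' : B, b ≠ b' → Disjoint (F b) (F b')) ∧
    (∀ b : B, ∃ hb : (b : X) ∈ F b, IsQuasicone (⟨(b : X), hb⟩ : F b))

/-! ### Singular chains -/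

/-- The topological standard `n`-simplex. -/
abbrev TopSimplex (n : ℕ) : Type := ↥(stdSimplex ℝ (Fin (n + 1)))

/-- Singular `n`-simplices in `X`. -/
abbrev SingularSimplex (X : Type*) [TopologicalSpace X] (n : ℕ) := C(TopSimplex n, X)

/-- Singular `n`-chains in `X` with coefficients in `R`. -/
abbrev SingularChain (R : Type*) [Ring R] (X : Type*) [TopologicalSpace X] (n : ℕ) :=
  SingularSimplex X n →₀ R

/-- The `i`-th coface map, on barycentric coordinates. -/
def cofaceFun {n : ℕ} (i : Fin (n + 2)) (x : Fin (n + 1) → ℝ) : Fin (n + 2) → ℝ :=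
  fun j => ∑ k : Fin (n + 1), if i.succAbove k = j then x k else 0

lemma cofaceFun_mem {n : ℕ} (i : Fin (n + 2)) {x : Fin (n + 1) → ℝ}
    (hx : x ∈ stdSimplex ℝ (Fin (n + 1))) : cofaceFun i x ∈ stdSimplex ℝ (Fin (n + 2)) := by
  constructor
  · intro j
    refine Finset.sum_nonneg fun k _ => ?_
    split_ifs
    · exact hx.1 k
    · exact le_rfl
  · unfold cofaceFun
    rw [Finset.sum_comm]
    simp only [Finset.sum_ite_eq, Finset.mem_univ, if_true]
    exact hx.2

/-- The `i`-th face inclusion `Δⁿ → Δⁿ⁺¹`. -/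
def coface {n : ℕ} (i : Fin (n + 2)) : C(TopSimplex n, TopSimplex (n + 1)) where
  toFun x := ⟨cofaceFun i (x : Fin (n + 1) → ℝ), cofaceFun_mem i x.2⟩
  continuous_toFun := by
    refine Continuous.subtype_mk ?_ _
    refine continuous_pi fun j => ?_
    unfold cofaceFun
    refine continuous_finset_sum _ fun k _ => ?_
    by_cases h : i.succAbove k = j
    · simp only [if_pos h]
      exact (continuous_apply k).comp continuous_subtype_val
    · simp only [if_neg h]
      exact continuous_const

/-- The boundary of a single `(n+1)`-simplex. -/
def boundaryOf (R : Type*) [Ring R] {X : Type*} [TopologicalSpace X] {n : ℕ}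
    (σ : SingularSimplex X (n + 1)) : SingularChain R X n :=
  ∑ i : Fin (n + 2), Finsupp.single (σ.comp (coface i)) ((-1 : R) ^ (i : ℕ))

/-- The singular boundary operator. -/
def boundary (R : Type*) [Ring R] (X : Type*) [TopologicalSpace X] (n : ℕ) :
    SingularChain R X (n + 1) →ₗ[R] SingularChain R X n :=
  Finsupp.lsum ℕ fun σ => LinearMap.toSpanSingleton R _ (boundaryOf R σ)

/-- Push-forward of chains along a continuous map. -/
def pushChain (R : Type*) [Ring R] {X Y : Type*} [TopologicalSpace X] [TopologicalSpace Y]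
    (f : C(X, Y)) (n : ℕ) : SingularChain R X n →ₗ[R] SingularChain R Y n :=
  Finsupp.lmapDomain R R fun σ : SingularSimplex X n => f.comp σ

/-- The face of `Δⁿ` spanned by the vertices in `S`. -/
def faceSet (n : ℕ) (S : Finset (Fin (n + 1))) : Set (TopSimplex n) :=
  {x | ∀ j ∉ S, (x : Fin (n + 1) → ℝ) j = 0}

/-- A subset of `Δⁿ` which is a union of (not necessarily proper) faces. -/
def IsSimplicialSubcomplex {n : ℕ} (A : Set (TopSimplex n)) : Prop :=
  ∃ 𝒮 : Set (Finset (Fin (n + 1))), A = ⋃ S ∈ 𝒮, faceSet n S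

/-- A singular simplex is *admissible* if the preimage of `B` is a union of faces. -/
def Admissible {X : Type*} [TopologicalSpace X] (B : Set X) {n : ℕ}
    (σ : SingularSimplex X n) : Prop :=
  IsSimplicialSubcomplex (σ ⁻¹' B)

/-- The submodule generated by admissible simplices. -/
def admissibleChains (R : Type*) [Ring R] (X : Type*) [TopologicalSpace X] (B : Set X)
    (n : ℕ) : Submodule R (SingularChain R X n) :=
  Submodule.span R {c | ∃ σ : SingularSimplex X n, Admissible B σ ∧ c = Finsupp.single σ 1}

/-- The submodule generated by simplices supported in `B`. -/
def chainsIn (R : Type*) [Ring R] (X : Type*) [TopologicalSpace X] (B : Set X)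
    (n : ℕ) : Submodule R (SingularChain R X n) :=
  Submodule.span R {c | ∃ σ : SingularSimplex X n, Set.range ⇑σ ⊆ B ∧ c = Finsupp.single σ 1}

/-- Cycles of the marked chain complex `C^M_*(X,B;R) = Ĉ^M_*(X,B;R)/C_*(B;R)`:
admissible chains whose boundary is supported in `B`. -/
def markedCycles (R : Type*) [Ring R] (X : Type*) [TopologicalSpace X] (B : Set X) :
    (n : ℕ) → Submodule R (SingularChain R X n)
  | 0 => admissibleChains R X B 0
  | (n + 1) => admissibleChains R X B (n + 1) ⊓
      Submodule.comap (boundary R X n) (chainsIn R X B n)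

/-- Boundaries of the marked chain complex. -/
def markedBoundaries (R : Type*) [Ring R] (X : Type*) [TopologicalSpace X] (B : Set X)
    (n : ℕ) : Submodule R (SingularChain R X n) :=
  Submodule.map (boundary R X n) (admissibleChains R X B (n + 1)) ⊔ chainsIn R X B n

/-- Relative cycles of the pair `(X, B)`. -/
def relativeCycles (R : Type*) [Ring R] (X : Type*) [TopologicalSpace X] (B : Set X) :
    (n : ℕ) → Submodule R (SingularChain R X n)
  | 0 => ⊤
  | (n + 1) => Submodule.comap (boundary R X n) (chainsIn R X B n)

/-- Relative boundaries of the pair `(X, B)`. -/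
def relativeBoundaries (R : Type*) [Ring R] (X : Type*) [TopologicalSpace X] (B : Set X)
    (n : ℕ) : Submodule R (SingularChain R X n) :=
  Submodule.map (boundary R X n) ⊤ ⊔ chainsIn R X B n

/-- The ℓ¹-norm of a real singular chain. -/
def l1Norm {X : Type*} [TopologicalSpace X] {n : ℕ} (c : SingularChain ℝ X n) : ℝ :=
  c.sum fun _ r => |r|

/-! ### The marked space associated to a manifold with boundary, and simplicial volumes -/

/-- The relation collapsing each connected component of `bd` to a point. -/
def collapseRel (X : Type*) (bd : Set X) [TopologicalSpace X] : X → X → Prop := fun a b =>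
  a = b ∨ (a ∈ bd ∧ b ∈ bd ∧ connectedComponentIn bd a = connectedComponentIn bd b)

/-- The quotient of `X` obtained by collapsing each connected component of `bd`
to a point. -/
abbrev Collapse (X : Type*) [TopologicalSpace X] (bd : Set X) : Type _ :=
  Quot (collapseRel X bd)

/-- The natural projection onto the collapsed space. -/
def collapseMap (X : Type*) [TopologicalSpace X] (bd : Set X) : C(X, Collapse X bd) :=
  ⟨Quot.mk _, continuous_quot_mk⟩

/-- The marked points: the images of the components of `bd`. -/
def collapsedBoundary (X : Type*) [TopologicalSpace X] (bd : Set X) : Set (Collapse X bd) :=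
  (collapseMap X bd) '' bd

/-- `ζ` is a relative fundamental cycle: it is a relative cycle which is not a relative
boundary, and whose class generates `H_n(X, bd; ℝ)`. -/
def IsFundamentalClassData (X : Type*) [TopologicalSpace X] (bd : Set X) (n : ℕ)
    (ζ : SingularChain ℝ X n) : Prop :=
  ζ ∈ relativeCycles ℝ X bd n ∧ ζ ∉ relativeBoundaries ℝ X bd n ∧
    ∀ z ∈ relativeCycles ℝ X bd n, ∃ r : ℝ, z - r • ζ ∈ relativeBoundaries ℝ X bd n

/-- `bd` admits a closed collar inside `X`. -/
def HasBoundaryCollar (X : Type*) [TopologicalSpace X] (bd : Set X) : Prop :=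
  ∃ φ : C((↥bd) × unitInterval, X), IsClosedEmbedding φ ∧ (∀ x : bd, φ (x, 0) = (x : X)) ∧
    Set.range φ ∈ nhdsSet bd ∧ ∀ (x : bd) (t : unitInterval), φ (x, t) ∈ bd ↔ t = 0

/-- Encoding of "`X` is a compact connected oriented topological `n`-manifold with
boundary `bd` and (real) relative fundamental cycle `ζ`". -/
structure IsCptMfdBdry (X : Type*) [TopologicalSpace X] (bd : Set X) (n : ℕ)
    (ζ : SingularChain ℝ X n) : Prop where
  compact : CompactSpace X
  connected : ConnectedSpace X
  bd_closed : IsClosed bd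
  collar : HasBoundaryCollar X bd
  fund : IsFundamentalClassData X bd n ζ

/-- Gromov's simplicial volume `‖M‖`: the infimum of the ℓ¹-norms of the relative cycles
representing the (class of the) relative fundamental cycle `ζ`. -/
def simplicialVolume (X : Type*) [TopologicalSpace X] (bd : Set X) (n : ℕ)
    (ζ : SingularChain ℝ X n) : ℝ :=
  sInf { r | ∃ z, z ∈ relativeCycles ℝ X bd n ∧
    z - ζ ∈ relativeBoundaries ℝ X bd n ∧ r = l1Norm z }

/-- The push-forward of the fundamental cycle to the marked space associated to `(X, bd)`. -/
def idealFundamentalRep (X : Type*) [TopologicalSpace X] (bd : Set X) (n : ℕ)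
    (ζ : SingularChain ℝ X n) : SingularChain ℝ (Collapse X bd) n :=
  pushChain ℝ (collapseMap X bd) n ζ

/-- `z` is a marked cycle representing the ideal fundamental class `[M, ∂M]^M`. -/
def IdealRepresents (X : Type*) [TopologicalSpace X] (bd : Set X) (n : ℕ)
    (ζ : SingularChain ℝ X n) (z : SingularChain ℝ (Collapse X bd) n) : Prop :=
  z ∈ markedCycles ℝ (Collapse X bd) (collapsedBoundary X bd) n ∧
    z - idealFundamentalRep X bd n ζ ∈
      relativeBoundaries ℝ (Collapse X bd) (collapsedBoundary X bd) n

/-- The ideal simplicial volume `‖M‖_I`: the infimum of the ℓ¹-norms of the marked cycles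
representing the ideal fundamental class. -/
def idealSimplicialVolume (X : Type*) [TopologicalSpace X] (bd : Set X) (n : ℕ)
    (ζ : SingularChain ℝ X n) : ℝ :=
  sInf { r | ∃ z, IdealRepresents X bd n ζ z ∧ r = l1Norm z }

/-! ### Chains on tuples of vertices and the combinatorial prism operator -/

/-- Chains on `m`-tuples of elements of `V`. -/
abbrev TupleChain (V : Type*) (m : ℕ) := (Fin m → V) →₀ ℝ

/-- The alternating sum of the faces of a tuple, extended linearly. -/
def tupleBoundary (V : Type*) (m : ℕ) : TupleChain V (m + 1) →ₗ[ℝ] TupleChain V m :=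
  Finsupp.linearCombination ℝ fun τ =>
    ∑ i : Fin (m + 1), Finsupp.single (τ ∘ i.succAbove) ((-1 : ℝ) ^ (i : ℕ))

/-- Prepend the vertex `v` to every tuple of a chain. -/
def tupleCone {V : Type*} (v : V) (m : ℕ) : TupleChain V m →ₗ[ℝ] TupleChain V (m + 1) :=
  Finsupp.lmapDomain ℝ ℝ fun τ => (Fin.cons v τ : Fin (m + 1) → V)

/-- Push-forward of tuple chains along a map of vertices. -/
def tuplePush {V W : Type*} (f : V → W) (m : ℕ) : TupleChain V m →ₗ[ℝ] TupleChain W m :=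
  Finsupp.lmapDomain ℝ ℝ fun τ => f ∘ τ

lemma tupleBoundary_single {V : Type*} {m : ℕ} (τ : Fin (m + 1) → V) :
    tupleBoundary V m (Finsupp.single τ 1) =
      ∑ i : Fin (m + 1), Finsupp.single (τ ∘ i.succAbove) ((-1 : ℝ) ^ (i : ℕ)) := by
  simp [tupleBoundary]

@[simp]
lemma tupleCone_single {V : Type*} (v : V) {m : ℕ} (τ : Fin m → V) (r : ℝ) :
    tupleCone v m (Finsupp.single τ r) = Finsupp.single (Fin.cons v τ : Fin (m + 1) → V) r := by
  simp [tupleCone]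

@[simp]
lemma tuplePush_single {V W : Type*} (f : V → W) {m : ℕ} (τ : Fin m → V) (r : ℝ) :
    tuplePush f m (Finsupp.single τ r) = Finsupp.single (f ∘ τ) r := by
  simp [tuplePush]

lemma tupleBoundary_tupleCone {V : Type*} (v : V) (m : ℕ) (c : TupleChain V (m + 1)) :
    tupleBoundary V (m + 1) (tupleCone v (m + 1) c) = c - tupleCone v m (tupleBoundary V m c) := by
  suffices h : tupleBoundary V (m + 1) ∘ₗ tupleCone v (m + 1) =
      LinearMap.id - tupleCone v m ∘ₗ tupleBoundary V m from LinearMap.congr_fun h c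
  refine Finsupp.lhom_ext' fun τ => LinearMap.ext_ring ?_
  simp only [LinearMap.comp_apply, Finsupp.lsingle_apply, LinearMap.sub_apply, LinearMap.id_apply,
    tupleCone_single, tupleBoundary_single, map_sum]
  rw [Fin.sum_univ_succ, sub_eq_add_neg, ← Finset.sum_neg_distrib]
  congr 1
  refine Finset.sum_congr rfl fun i _ => ?_
  rw [← Finsupp.single_neg, Fin.val_succ, pow_succ, mul_neg_one]
  congr 1
  funext j
  refine Fin.cases ?_ (fun j => ?_) j <;> simp

lemma tuplePush_tupleBoundary {V W : Type*} (f : V → W) (m : ℕ) (c : TupleChain V (m + 1)) :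
    tuplePush f m (tupleBoundary V m c) = tupleBoundary W m (tuplePush f (m + 1) c) := by
  suffices h : tuplePush f m ∘ₗ tupleBoundary V m = tupleBoundary W m ∘ₗ tuplePush f (m + 1) from
    LinearMap.congr_fun h c
  refine Finsupp.lhom_ext' fun τ => LinearMap.ext_ring ?_
  simp [tupleBoundary_single, Function.comp_assoc]

lemma comp_cons {V W : Type*} (f : V → W) (v : V) {m : ℕ} (τ : Fin m → V) :
    f ∘ (Fin.cons v τ : Fin (m + 1) → V) = Fin.cons (f v) (f ∘ τ) := by
  funext j
  refine Fin.cases ?_ (fun j => ?_) j <;> simp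

lemma tuplePush_tupleCone {V W : Type*} (f : V → W) (v : V) (m : ℕ) (c : TupleChain V m) :
    tuplePush f (m + 1) (tupleCone v m c) = tupleCone (f v) m (tuplePush f m c) := by
  suffices h : tuplePush f (m + 1) ∘ₗ tupleCone v m = tupleCone (f v) m ∘ₗ tuplePush f m from
    LinearMap.congr_fun h c
  refine Finsupp.lhom_ext' fun τ => LinearMap.ext_ring ?_
  simp [comp_cons]

/-- The prism over a tuple, with bottom copy given by `a` and top copy given by `b`. -/
def prismOf {V W : Type*} (a b : V → W) : (m : ℕ) → (Fin m → V) → TupleChain W (m + 1)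
  | 0, _ => 0
  | m + 1, τ => tupleCone (a (τ 0)) (m + 1)
      (Finsupp.single (b ∘ τ) 1 - prismOf a b m (Fin.tail τ))

/-- The linear extension of `prismOf`. -/
def prism {V W : Type*} (a b : V → W) (m : ℕ) : TupleChain V m →ₗ[ℝ] TupleChain W (m + 1) :=
  Finsupp.linearCombination ℝ (prismOf a b m)

@[simp]
lemma prism_single {V W : Type*} (a b : V → W) {m : ℕ} (τ : Fin m → V) :
    prism a b m (Finsupp.single τ 1) = prismOf a b m τ := by
  simp [prism]

lemma prism_zero {V W : Type*} (a b : V → W) (c : TupleChain V 0) : prism a b 0 c = 0 := by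
  suffices h : prism a b 0 = 0 by rw [h, LinearMap.zero_apply]
  refine Finsupp.lhom_ext' fun τ => LinearMap.ext_ring ?_
  simp [prismOf]

lemma prism_tupleCone {V W : Type*} (a b : V → W) (v : V) (m : ℕ) (c : TupleChain V m) :
    prism a b (m + 1) (tupleCone v m c) = tupleCone (a v) (m + 1)
      (tupleCone (b v) m (tuplePush b m c) - prism a b m c) := by
  suffices h : prism a b (m + 1) ∘ₗ tupleCone v m = tupleCone (a v) (m + 1) ∘ₗ
      (tupleCone (b v) m ∘ₗ tuplePush b m - prism a b m) from LinearMap.congr_fun h c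
  refine Finsupp.lhom_ext' fun τ => LinearMap.ext_ring ?_
  simp [prismOf, comp_cons]

/-- The prism operator is a chain homotopy between the two push-forwards. -/
lemma tupleBoundary_prism {V W : Type*} (a b : V → W) (m : ℕ) (c : TupleChain V (m + 1)) :
    tupleBoundary W (m + 1) (prism a b (m + 1) c) =
      tuplePush b (m + 1) c - tuplePush a (m + 1) c - prism a b m (tupleBoundary V m c) := by
  induction m with
  | zero =>
    suffices h : tupleBoundary W 1 ∘ₗ prism a b 1 = tuplePush b 1 - tuplePush a 1 by
      rw [prism_zero, sub_zero]
      exact LinearMap.congr_fun h c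
    refine Finsupp.lhom_ext' fun τ => LinearMap.ext_ring ?_
    simp only [LinearMap.comp_apply, Finsupp.lsingle_apply, LinearMap.sub_apply, prism_single,
      prismOf, tuplePush_single, sub_zero, tupleBoundary_tupleCone, tupleBoundary_single]
    rw [Fin.sum_univ_one, tupleCone_single]
    congr 2
    funext j
    obtain rfl := Subsingleton.elim (α := Fin 1) j 0
    rfl
  | succ m ih =>
    suffices h : tupleBoundary W (m + 2) ∘ₗ prism a b (m + 2) =
        tuplePush b (m + 2) - tuplePush a (m + 2) - prism a b (m + 1) ∘ₗ tupleBoundary V (m + 1) from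
      LinearMap.congr_fun h c
    refine Finsupp.lhom_ext' fun τ => LinearMap.ext_ring ?_
    obtain ⟨v, τ, rfl⟩ : ∃ v τ', τ = (Fin.cons v τ' : Fin (m + 2) → V) :=
      ⟨τ 0, Fin.tail τ, (Fin.cons_self_tail τ).symm⟩
    simp only [LinearMap.comp_apply, Finsupp.lsingle_apply, LinearMap.sub_apply]
    rw [← tupleCone_single, prism_tupleCone, tupleBoundary_tupleCone, map_sub, ih,
      tupleBoundary_tupleCone, tupleBoundary_tupleCone, map_sub (prism a b (m + 1)), prism_tupleCone,
      tuplePush_tupleCone, tuplePush_tupleCone, tuplePush_tupleBoundary]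
    simp only [map_sub, prism_single]
    abel

lemma tuplePush_prismOf {V V' W W' : Type*} (a b : V → W) (a' b' : V' → W') (f : V → V')
    (g : W → W') (ha : g ∘ a = a' ∘ f) (hb : g ∘ b = b' ∘ f) (m : ℕ) (τ : Fin m → V) :
    tuplePush g (m + 1) (prismOf a b m τ) = prismOf a' b' m (f ∘ τ) := by
  induction m with
  | zero => simp [prismOf]
  | succ m ih =>
    rw [prismOf, prismOf, tuplePush_tupleCone, map_sub, ih, tuplePush_single,
      ← Function.comp_assoc, hb, Function.comp_assoc]
    exact congrArg (fun w => tupleCone w _ _) (congrFun ha (τ 0))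

/-! ### Affine simplices in a prism -/

lemma coface_eq_map {n : ℕ} (i : Fin (n + 2)) (x : TopSimplex n) :
    coface i x = stdSimplex.map i.succAbove x := by
  ext j
  change (∑ k : Fin (n + 1), if i.succAbove k = j then (x : Fin (n + 1) → ℝ) k else 0) = _
  rw [stdSimplex.map_coe, FunOnFinite.linearMap_apply_apply, Finset.sum_filter]

/-- The affine simplex in `Δⁿ × [0, 1]` with the given vertices, where `false` stands for the
bottom of the prism and `true` for its top. -/
def prismSimplex {m n : ℕ} (τ : Fin (m + 1) → Fin (n + 1) × Bool) :
    C(TopSimplex m, TopSimplex n × unitInterval) where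
  toFun x := (stdSimplex.map (Prod.fst ∘ τ) x,
    ⟨stdSimplex.map (Prod.snd ∘ τ) x true, stdSimplex.zero_le _ _, stdSimplex.le_one _ _⟩)
  continuous_toFun := by
    refine (stdSimplex.continuous_map _).prodMk (Continuous.subtype_mk ?_ _)
    exact (continuous_apply true).comp
      (continuous_subtype_val.comp (stdSimplex.continuous_map (S := ℝ) (Prod.snd ∘ τ)))

lemma prismSimplex_coface {m n : ℕ} (τ : Fin (m + 2) → Fin (n + 1) × Bool) (i : Fin (m + 2)) :
    (prismSimplex τ).comp (coface i) = prismSimplex (τ ∘ i.succAbove) := by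
  ext1 x
  simp only [prismSimplex, ContinuousMap.comp_apply, ContinuousMap.coe_mk, coface_eq_map,
    stdSimplex.map_comp_apply]
  rfl

lemma prismSimplex_comp_fst {m n : ℕ} (τ : Fin (m + 1) → Fin (n + 1) × Bool) (i : Fin (n + 2))
    (x : TopSimplex m) : prismSimplex (Prod.map i.succAbove id ∘ τ) x =
      (coface i (prismSimplex τ x).1, (prismSimplex τ x).2) := by
  simp only [prismSimplex, ContinuousMap.coe_mk, coface_eq_map, stdSimplex.map_comp_apply]
  rfl

lemma prismSimplex_bottom {n : ℕ} (x : TopSimplex n) :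
    prismSimplex (fun j : Fin (n + 1) => (j, false)) x = (x, 0) := by
  refine Prod.ext (stdSimplex.map_id_apply x) (Subtype.ext ?_)
  change stdSimplex.map (fun _ => false) x true = 0
  rw [stdSimplex.map_coe, FunOnFinite.linearMap_apply_apply]
  simp

lemma prismSimplex_top {n : ℕ} (x : TopSimplex n) :
    prismSimplex (fun j : Fin (n + 1) => (j, true)) x = (x, 1) := by
  refine Prod.ext (stdSimplex.map_id_apply x) (Subtype.ext ?_)
  change stdSimplex.map (fun _ => true) x true = 1
  rw [stdSimplex.map_coe, FunOnFinite.linearMap_apply_apply]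
  simp

/-! ### Natural homotopies of singular simplices -/

lemma boundary_single {R X : Type*} [Ring R] [TopologicalSpace X] {n : ℕ}
    (σ : SingularSimplex X (n + 1)) : boundary R X n (Finsupp.single σ 1) = boundaryOf R σ := by
  simp [boundary]

/-- Send each tuple to the corresponding affine simplex in the prism, followed by `h`. -/
def realize {X : Type*} [TopologicalSpace X] {n : ℕ} (h : C(TopSimplex n × unitInterval, X))
    (m : ℕ) : TupleChain (Fin (n + 1) × Bool) (m + 1) →ₗ[ℝ] SingularChain ℝ X m :=
  Finsupp.lmapDomain ℝ ℝ fun τ => h.comp (prismSimplex τ)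

@[simp]
lemma realize_single {X : Type*} [TopologicalSpace X] {n : ℕ}
    (h : C(TopSimplex n × unitInterval, X)) {m : ℕ} (τ : Fin (m + 1) → Fin (n + 1) × Bool)
    (r : ℝ) : realize h m (Finsupp.single τ r) = Finsupp.single (h.comp (prismSimplex τ)) r := by
  simp [realize]

lemma boundary_realize {X : Type*} [TopologicalSpace X] {n : ℕ}
    (h : C(TopSimplex n × unitInterval, X)) (m : ℕ)
    (c : TupleChain (Fin (n + 1) × Bool) (m + 2)) :
    boundary ℝ X m (realize h (m + 1) c) = realize h m (tupleBoundary _ (m + 1) c) := by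
  suffices H : boundary ℝ X m ∘ₗ realize h (m + 1) = realize h m ∘ₗ tupleBoundary _ (m + 1) from
    LinearMap.congr_fun H c
  refine Finsupp.lhom_ext' fun τ => LinearMap.ext_ring ?_
  simp [tupleBoundary_single, boundary_single, boundaryOf, ContinuousMap.comp_assoc,
    prismSimplex_coface]

lemma realize_mem_chainsIn {X : Type*} [TopologicalSpace X] {B : Set X} {n : ℕ}
    (h : C(TopSimplex n × unitInterval, X)) (hB : ∀ p, h p ∈ B) (m : ℕ)
    (c : TupleChain (Fin (n + 1) × Bool) (m + 1)) : realize h m c ∈ chainsIn ℝ X B m := by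
  induction c using Finsupp.induction_linear with
  | zero => simp
  | add c d hc hd => rw [map_add]; exact add_mem hc hd
  | single τ r =>
    rw [realize_single, ← Finsupp.smul_single_one]
    refine Submodule.smul_mem _ _ (Submodule.subset_span ⟨_, ?_, rfl⟩)
    rintro _ ⟨x, rfl⟩
    exact hB _

/-- A homotopy of every singular simplex of `X`, compatible with faces. -/
structure NaturalHomotopy (X : Type*) [TopologicalSpace X] where
  /-- The homotopy of a given simplex. -/
  toFun : ∀ {n : ℕ}, SingularSimplex X n → C(TopSimplex n × unitInterval, X)
  start : ∀ {n : ℕ} (σ : SingularSimplex X n) (x : TopSimplex n), toFun σ (x, 0) = σ x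
  face : ∀ {n : ℕ} (σ : SingularSimplex X (n + 1)) (i : Fin (n + 2)) (x : TopSimplex n)
    (t : unitInterval), toFun (σ.comp (coface i)) (x, t) = toFun σ (coface i x, t)

namespace NaturalHomotopy

variable {X : Type*} [TopologicalSpace X] (H : NaturalHomotopy X)

/-- The final simplex of the homotopy. -/
def endSimplex {n : ℕ} (σ : SingularSimplex X n) : SingularSimplex X n :=
  (H.toFun σ).comp ((ContinuousMap.id _).prodMk (ContinuousMap.const _ 1))

lemma endSimplex_coface {n : ℕ} (σ : SingularSimplex X (n + 1)) (i : Fin (n + 2)) :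
    H.endSimplex (σ.comp (coface i)) = (H.endSimplex σ).comp (coface i) := by
  ext1 x
  exact H.face σ i x 1

/-- The chain map replacing each simplex by the end of its homotopy. -/
def endMap (n : ℕ) : SingularChain ℝ X n →ₗ[ℝ] SingularChain ℝ X n :=
  Finsupp.lmapDomain ℝ ℝ H.endSimplex

@[simp]
lemma endMap_single {n : ℕ} (σ : SingularSimplex X n) (r : ℝ) :
    H.endMap n (Finsupp.single σ r) = Finsupp.single (H.endSimplex σ) r := by
  simp [endMap]

lemma boundary_endMap (n : ℕ) (c : SingularChain ℝ X (n + 1)) :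
    boundary ℝ X n (H.endMap (n + 1) c) = H.endMap n (boundary ℝ X n c) := by
  suffices h : boundary ℝ X n ∘ₗ H.endMap (n + 1) = H.endMap n ∘ₗ boundary ℝ X n from
    LinearMap.congr_fun h c
  refine Finsupp.lhom_ext' fun σ => LinearMap.ext_ring ?_
  simp [boundary_single, boundaryOf, endSimplex_coface]

/-- The image in `X` of the prism decomposition of `Δⁿ × [0, 1]`. -/
def homotopyOf {n : ℕ} (σ : SingularSimplex X n) : SingularChain ℝ X (n + 1) :=
  realize (H.toFun σ) (n + 1) (prismOf (·, false) (·, true) (n + 1) id)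

/-- The chain homotopy from the identity to `endMap`. -/
def chainHomotopy (n : ℕ) : SingularChain ℝ X n →ₗ[ℝ] SingularChain ℝ X (n + 1) :=
  Finsupp.linearCombination ℝ H.homotopyOf

@[simp]
lemma chainHomotopy_single {n : ℕ} (σ : SingularSimplex X n) (r : ℝ) :
    H.chainHomotopy n (Finsupp.single σ r) = r • H.homotopyOf σ := by
  simp [chainHomotopy]

lemma realize_toFun_face {n : ℕ} (σ : SingularSimplex X (n + 1)) (i : Fin (n + 2)) (m : ℕ)
    (c : TupleChain (Fin (n + 1) × Bool) (m + 1)) :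
    realize (H.toFun σ) m (tuplePush (Prod.map i.succAbove id) (m + 1) c) =
      realize (H.toFun (σ.comp (coface i))) m c := by
  suffices h : realize (H.toFun σ) m ∘ₗ tuplePush (Prod.map i.succAbove id) (m + 1) =
      realize (H.toFun (σ.comp (coface i))) m from LinearMap.congr_fun h c
  refine Finsupp.lhom_ext' fun τ => LinearMap.ext_ring ?_
  simp only [LinearMap.comp_apply, Finsupp.lsingle_apply, tuplePush_single, realize_single]
  congr 1
  ext1 x
  simp only [ContinuousMap.comp_apply, prismSimplex_comp_fst]
  exact (H.face σ i _ _).symm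

lemma boundary_homotopyOf {n : ℕ} (σ : SingularSimplex X n) :
    boundary ℝ X n (H.homotopyOf σ) = Finsupp.single (H.endSimplex σ) 1 - Finsupp.single σ 1 -
      realize (H.toFun σ) n (prism (·, false) (·, true) n
        (tupleBoundary (Fin (n + 1)) n (Finsupp.single id 1))) := by
  have htop : (H.toFun σ).comp (prismSimplex ((·, true) ∘ id)) = H.endSimplex σ :=
    ContinuousMap.ext fun x => congrArg (H.toFun σ) (prismSimplex_top x)
  have hbot : (H.toFun σ).comp (prismSimplex ((·, false) ∘ id)) = σ :=
    ContinuousMap.ext fun x => (congrArg (H.toFun σ) (prismSimplex_bottom x)).trans (H.start σ x)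
  rw [homotopyOf, boundary_realize, ← prism_single, tupleBoundary_prism, map_sub, map_sub,
    tuplePush_single, tuplePush_single, realize_single, realize_single, htop, hbot]

lemma boundary_chainHomotopy_zero (c : SingularChain ℝ X 0) :
    boundary ℝ X 0 (H.chainHomotopy 0 c) = H.endMap 0 c - c := by
  suffices h : boundary ℝ X 0 ∘ₗ H.chainHomotopy 0 = H.endMap 0 - LinearMap.id from
    LinearMap.congr_fun h c
  refine Finsupp.lhom_ext' fun σ => LinearMap.ext_ring ?_
  simp [boundary_homotopyOf, prism_zero]

lemma boundary_chainHomotopy_succ (n : ℕ) (c : SingularChain ℝ X (n + 1)) :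
    boundary ℝ X (n + 1) (H.chainHomotopy (n + 1) c) =
      H.endMap (n + 1) c - c - H.chainHomotopy n (boundary ℝ X n c) := by
  suffices h : boundary ℝ X (n + 1) ∘ₗ H.chainHomotopy (n + 1) =
      H.endMap (n + 1) - LinearMap.id - H.chainHomotopy n ∘ₗ boundary ℝ X n from
    LinearMap.congr_fun h c
  refine Finsupp.lhom_ext' fun σ => LinearMap.ext_ring ?_
  simp only [LinearMap.comp_apply, Finsupp.lsingle_apply, LinearMap.sub_apply, LinearMap.id_apply,
    chainHomotopy_single, one_smul, boundary_homotopyOf, endMap_single, boundary_single]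
  congr 1
  rw [tupleBoundary_single, boundaryOf, map_sum, map_sum, map_sum]
  refine Finset.sum_congr rfl fun i _ => ?_
  rw [chainHomotopy_single, homotopyOf, ← realize_toFun_face,
    tuplePush_prismOf (·, false) (·, true) (·, false) (·, true) i.succAbove _ rfl rfl,
    ← Finsupp.smul_single_one, map_smul, map_smul, prism_single]
  rfl

variable {B : Set X}

lemma endMap_mem_chainsIn
    (hB : ∀ {n : ℕ} (σ : SingularSimplex X n), Set.range ⇑σ ⊆ B → ∀ p, H.toFun σ p ∈ B)
    {n : ℕ} {c : SingularChain ℝ X n} (hc : c ∈ chainsIn ℝ X B n) :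
    H.endMap n c ∈ chainsIn ℝ X B n := by
  suffices h : chainsIn ℝ X B n ≤ (chainsIn ℝ X B n).comap (H.endMap n) from h hc
  refine Submodule.span_le.2 ?_
  rintro _ ⟨σ, hσ, rfl⟩
  refine Submodule.subset_span ⟨H.endSimplex σ, ?_, H.endMap_single σ 1⟩
  rintro _ ⟨x, rfl⟩
  exact hB σ hσ _

lemma chainHomotopy_mem_chainsIn
    (hB : ∀ {n : ℕ} (σ : SingularSimplex X n), Set.range ⇑σ ⊆ B → ∀ p, H.toFun σ p ∈ B)
    {n : ℕ} {c : SingularChain ℝ X n} (hc : c ∈ chainsIn ℝ X B n) :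
    H.chainHomotopy n c ∈ chainsIn ℝ X B (n + 1) := by
  suffices h : chainsIn ℝ X B n ≤ (chainsIn ℝ X B (n + 1)).comap (H.chainHomotopy n) from h hc
  refine Submodule.span_le.2 ?_
  rintro _ ⟨σ, hσ, rfl⟩
  simpa [homotopyOf] using realize_mem_chainsIn _ (hB σ hσ) (n + 1) _

lemma endMap_sub_mem_relativeBoundaries
    (hB : ∀ {n : ℕ} (σ : SingularSimplex X n), Set.range ⇑σ ⊆ B → ∀ p, H.toFun σ p ∈ B)
    {n : ℕ} {c : SingularChain ℝ X n} (hc : c ∈ relativeCycles ℝ X B n) :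
    H.endMap n c - c ∈ relativeBoundaries ℝ X B n := by
  cases n with
  | zero =>
    rw [← H.boundary_chainHomotopy_zero]
    exact Submodule.mem_sup_left (Submodule.mem_map_of_mem trivial)
  | succ n =>
    rw [sub_eq_iff_eq_add.1 (H.boundary_chainHomotopy_succ n c).symm]
    exact add_mem (Submodule.mem_sup_left (Submodule.mem_map_of_mem trivial))
      (Submodule.mem_sup_right (H.chainHomotopy_mem_chainsIn hB hc))

end NaturalHomotopy

/-! ### Functoriality of chains and norms -/

@[simp]
lemma pushChain_single {X Y : Type*} [TopologicalSpace X] [TopologicalSpace Y] (f : C(X, Y))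
    {n : ℕ} (σ : SingularSimplex X n) (r : ℝ) :
    pushChain ℝ f n (Finsupp.single σ r) = Finsupp.single (f.comp σ) r := by
  simp [pushChain]

lemma boundary_pushChain {X Y : Type*} [TopologicalSpace X] [TopologicalSpace Y] (f : C(X, Y))
    (n : ℕ) (c : SingularChain ℝ X (n + 1)) :
    boundary ℝ Y n (pushChain ℝ f (n + 1) c) = pushChain ℝ f n (boundary ℝ X n c) := by
  suffices h : boundary ℝ Y n ∘ₗ pushChain ℝ f (n + 1) = pushChain ℝ f n ∘ₗ boundary ℝ X n from
    LinearMap.congr_fun h c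
  refine Finsupp.lhom_ext' fun σ => LinearMap.ext_ring ?_
  simp [boundary_single, boundaryOf, ContinuousMap.comp_assoc]

lemma pushChain_mem_chainsIn {X Y : Type*} [TopologicalSpace X] [TopologicalSpace Y] (f : C(X, Y))
    {A : Set X} {B : Set Y} (hf : Set.MapsTo f A B) {n : ℕ} {c : SingularChain ℝ X n}
    (hc : c ∈ chainsIn ℝ X A n) : pushChain ℝ f n c ∈ chainsIn ℝ Y B n := by
  suffices h : chainsIn ℝ X A n ≤ (chainsIn ℝ Y B n).comap (pushChain ℝ f n) from h hc
  refine Submodule.span_le.2 ?_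
  rintro _ ⟨σ, hσ, rfl⟩
  refine Submodule.subset_span ⟨f.comp σ, ?_, pushChain_single f σ 1⟩
  rintro _ ⟨x, rfl⟩
  exact hf (hσ ⟨x, rfl⟩)

lemma pushChain_mem_relativeBoundaries {X Y : Type*} [TopologicalSpace X] [TopologicalSpace Y]
    (f : C(X, Y)) {A : Set X} {B : Set Y} (hf : Set.MapsTo f A B) {n : ℕ}
    {c : SingularChain ℝ X n} (hc : c ∈ relativeBoundaries ℝ X A n) :
    pushChain ℝ f n c ∈ relativeBoundaries ℝ Y B n := by
  obtain ⟨_, ⟨d, -, rfl⟩, e, he, rfl⟩ := Submodule.mem_sup.1 hc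
  rw [map_add, ← boundary_pushChain]
  exact add_mem (Submodule.mem_sup_left (Submodule.mem_map_of_mem trivial))
    (Submodule.mem_sup_right (pushChain_mem_chainsIn f hf he))

lemma l1Norm_nonneg {X : Type*} [TopologicalSpace X] {n : ℕ} (c : SingularChain ℝ X n) :
    0 ≤ l1Norm c :=
  Finset.sum_nonneg fun _ _ => abs_nonneg _

lemma l1Norm_mapDomain_le {X Y : Type*} [TopologicalSpace X] [TopologicalSpace Y] {m n : ℕ}
    (f : SingularSimplex X m → SingularSimplex Y n) (c : SingularChain ℝ X m) :
    l1Norm (Finsupp.mapDomain f c) ≤ l1Norm c := by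
  classical
  have key : ∀ d : SingularChain ℝ Y n, ∀ s : Finset (SingularSimplex Y n), d.support ⊆ s →
      l1Norm d = ∑ τ ∈ s, |d τ| := fun d s hs => Finsupp.sum_of_support_subset _ hs _ (by simp)
  rw [key _ _ Finsupp.mapDomain_support]
  calc ∑ τ ∈ c.support.image f, |Finsupp.mapDomain f c τ|
      ≤ ∑ τ ∈ c.support.image f, ∑ σ ∈ c.support with f σ = τ, |c σ| := by
        refine Finset.sum_le_sum fun τ _ => ?_
        rw [Finsupp.mapDomain, Finsupp.sum_apply, Finsupp.sum, Finset.sum_filter]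
        refine (Finset.abs_sum_le_sum_abs _ _).trans (Finset.sum_le_sum fun σ _ => ?_)
        rw [Finsupp.single_apply]
        split_ifs <;> simp
    _ = l1Norm c := Finset.sum_fiberwise_of_maps_to (fun σ hσ => Finset.mem_image_of_mem f hσ) _

/-! ### Pushing into the interior along a collar -/

/-- A collar gives a homotopy of the identity which leaves `bd` immediately. -/
lemma HasBoundaryCollar.exists_push {X : Type*} [TopologicalSpace X] [CompactSpace X] {bd : Set X}
    (hbd : IsClosed bd) (hcol : HasBoundaryCollar X bd) :
    ∃ G : C(X × unitInterval, X), (∀ x, G (x, 0) = x) ∧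
      ∀ x t, G (x, t) ∈ bd ↔ t = 0 ∧ x ∈ bd := by
  classical
  obtain ⟨φ, hφ, hφ0, hnhds, hφbd⟩ := hcol
  have : CompactSpace bd := isCompact_iff_compactSpace.1 hbd.isCompact
  have hbdU : bd ⊆ interior (Set.range φ) := subset_interior_iff_mem_nhdsSet.2 hnhds
  obtain ⟨c, hc0, hc⟩ : ∃ c : unitInterval, 0 < c ∧
      ∀ (b : bd) (s : unitInterval), s < c → φ (b, s) ∈ interior (Set.range φ) := by
    obtain ⟨u, v, -, hv, hu, h0v, huv⟩ := generalized_tube_lemma (isCompact_univ (X := bd))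
      (isCompact_singleton (x := (0 : unitInterval))) (isOpen_interior.preimage φ.continuous)
      (n := φ ⁻¹' interior (Set.range φ)) (by
        rintro ⟨b, s⟩ ⟨-, rfl⟩
        rw [Set.mem_preimage, hφ0]
        exact hbdU b.2)
    obtain ⟨c, hc0, hc⟩ := exists_Ico_subset_of_mem_nhds (hv.mem_nhds (h0v rfl))
      ⟨1, zero_lt_one⟩
    exact ⟨c, hc0, fun b s hs => huv ⟨hu trivial, hc ⟨s.2.1, hs⟩⟩⟩
  have hO : IsOpen (φ '' {p | p.2 < c}) := by
    obtain ⟨W, hW, hWeq⟩ := hφ.isInducing.isOpen_iff.1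
      (isOpen_lt continuous_snd continuous_const : IsOpen {p : bd × unitInterval | p.2 < c})
    have : φ '' {p | p.2 < c} = W ∩ interior (Set.range φ) := by
      rw [← hWeq]
      refine Set.Subset.antisymm ?_ ?_
      · rintro _ ⟨p, hp, rfl⟩
        exact ⟨hp, hc p.1 p.2 (hWeq.subset hp)⟩
      · rintro x ⟨hxW, hx⟩
        obtain ⟨p, rfl⟩ := interior_subset hx
        exact ⟨p, hxW, rfl⟩
    rw [this]
    exact hW.inter isOpen_interior
  let g : X × unitInterval → X := fun y =>
    if h : ∃ p, φ p = y.1 then φ (h.choose.1, max h.choose.2 (min y.2 c)) else y.1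
  have hg_col : ∀ p t, g (φ p, t) = φ (p.1, max p.2 (min t c)) := by
    intro p t
    have h : ∃ q, φ q = φ p := ⟨p, rfl⟩
    have hq : h.choose = p := hφ.injective h.choose_spec
    simp only [g, dif_pos h, hq]
  have hg_out : ∀ x t, x ∉ φ '' {p | p.2 < c} → g (x, t) = x := by
    intro x t hx
    by_cases h : ∃ p, φ p = x
    · obtain ⟨p, rfl⟩ := h
      have hp : c ≤ p.2 := not_lt.1 fun hp => hx ⟨p, hp, rfl⟩
      rw [hg_col, max_eq_left ((min_le_right _ _).trans hp)]
    · simp only [g, dif_neg h]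
  have hgc : Continuous g := by
    let C : Set X := (φ '' {p | p.2 < c})ᶜ
    let q : ((bd × unitInterval) × unitInterval) ⊕ (C × unitInterval) → X × unitInterval :=
      Sum.elim (Prod.map φ id) (Prod.map Subtype.val id)
    have hq : IsQuotientMap q := by
      refine IsClosedMap.isQuotientMap ?_ ?_ ?_
      · exact ((hφ.prodMap IsClosedEmbedding.id).isClosedMap).sumElim
          ((hO.isClosed_compl.isClosedEmbedding_subtypeVal.prodMap
            IsClosedEmbedding.id).isClosedMap)
      · exact (φ.continuous.prodMap continuous_id).sumElim
          (continuous_subtype_val.prodMap continuous_id)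
      · rintro ⟨x, t⟩
        by_cases hx : x ∈ φ '' {p | p.2 < c}
        · obtain ⟨p, -, rfl⟩ := hx
          exact ⟨Sum.inl (p, t), rfl⟩
        · exact ⟨Sum.inr (⟨x, hx⟩, t), rfl⟩
    rw [hq.continuous_iff]
    refine continuous_sum_dom.2 ⟨?_, ?_⟩
    · refine Continuous.congr (f := fun y : (bd × unitInterval) × unitInterval =>
        φ (y.1.1, max y.1.2 (min y.2 c))) (by fun_prop) fun y => (hg_col y.1 y.2).symm
    · exact Continuous.congr (f := fun y : C × unitInterval => (y.1 : X)) (by fun_prop)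
        fun y => (hg_out y.1 y.2 y.1.2).symm
  have hcol_or : ∀ x, (∃ p, φ p = x) ∨ (x ∉ φ '' {p | p.2 < c} ∧ x ∉ bd) := by
    intro x
    by_cases h : ∃ p, φ p = x
    · exact Or.inl h
    · exact Or.inr ⟨fun ⟨p, _, hp⟩ => h ⟨p, hp⟩, fun hx => h ⟨(⟨x, hx⟩, 0), hφ0 _⟩⟩
  refine ⟨⟨g, hgc⟩, fun x => ?_, fun x t => ?_⟩
  · rcases hcol_or x with ⟨p, rfl⟩ | ⟨hx, -⟩
    · exact (hg_col p 0).trans (by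
        rw [min_eq_left hc0.le, max_eq_left (show (0 : unitInterval) ≤ p.2 from p.2.2.1)])
    · exact hg_out x 0 hx
  · rcases hcol_or x with ⟨p, rfl⟩ | ⟨hx, hx'⟩
    · rw [ContinuousMap.coe_mk, hg_col, hφbd, hφbd]
      have hnn : ∀ s : unitInterval, s ≤ 0 ↔ s = 0 := fun s =>
        ⟨fun h => le_antisymm h s.2.1, le_of_eq⟩
      rw [← hnn, max_le_iff, min_le_iff, hnn, hnn, or_iff_left (not_le.2 hc0), and_comm]
    · rw [ContinuousMap.coe_mk, hg_out x t hx]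
      exact ⟨fun h => absurd h hx', fun h => h.2⟩

/-! ### The distance to the faces contained in the boundary -/

/-- The faces of `σ` which are contained in `B`. -/
def facesIn {X : Type*} [TopologicalSpace X] (B : Set X) {n : ℕ} (σ : SingularSimplex X n) :
    Set (Finset (Fin (n + 1))) :=
  {S | ∀ x ∈ faceSet n S, σ x ∈ B}

lemma empty_mem_facesIn {X : Type*} [TopologicalSpace X] (B : Set X) {n : ℕ}
    (σ : SingularSimplex X n) : ∅ ∈ facesIn B σ := by
  intro x hx
  have h : ∑ j, x j = 1 := x.2.2
  rw [Finset.sum_eq_zero fun j _ => hx j (Finset.notMem_empty j)] at h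
  exact absurd h zero_ne_one

open Classical in
lemma facesIn_filter_nonempty {X : Type*} [TopologicalSpace X] (B : Set X) {n : ℕ}
    (σ : SingularSimplex X n) : (Finset.univ.filter (· ∈ facesIn B σ)).Nonempty :=
  ⟨∅, by simpa using empty_mem_facesIn B σ⟩

open Classical in
/-- A function on `Δⁿ` vanishing exactly on the faces of `σ` contained in `B`. -/
def faceGap {X : Type*} [TopologicalSpace X] (B : Set X) {n : ℕ} (σ : SingularSimplex X n)
    (x : TopSimplex n) : ℝ :=
  (Finset.univ.filter (· ∈ facesIn B σ)).inf' (facesIn_filter_nonempty B σ)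
    fun S => 1 - ∑ j ∈ S, (x : Fin (n + 1) → ℝ) j

section FaceGap

variable {X : Type*} [TopologicalSpace X] (B : Set X) {n : ℕ}

lemma faceGap_le {σ : SingularSimplex X n} {S : Finset (Fin (n + 1))} (hS : S ∈ facesIn B σ)
    (x : TopSimplex n) : faceGap B σ x ≤ 1 - ∑ j ∈ S, (x : Fin (n + 1) → ℝ) j :=
  Finset.inf'_le _ (by simpa using hS)

lemma exists_faceGap_eq (σ : SingularSimplex X n) (x : TopSimplex n) :
    ∃ S ∈ facesIn B σ, faceGap B σ x = 1 - ∑ j ∈ S, (x : Fin (n + 1) → ℝ) j := by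
  classical
  obtain ⟨S, hS, h⟩ := Finset.exists_mem_eq_inf' (facesIn_filter_nonempty B σ)
    fun S => 1 - ∑ j ∈ S, (x : Fin (n + 1) → ℝ) j
  exact ⟨S, by simpa using hS, h⟩

lemma continuous_faceGap (σ : SingularSimplex X n) : Continuous (faceGap B σ) :=
  Continuous.finset_inf'_apply _ fun _ _ => continuous_const.sub
    (continuous_finsetSum _ fun j _ => (continuous_apply j).comp continuous_subtype_val)

lemma faceGap_mem_unitInterval (σ : SingularSimplex X n) (x : TopSimplex n) :
    faceGap B σ x ∈ unitInterval := by
  refine ⟨?_, by simpa using faceGap_le B (empty_mem_facesIn B σ) x⟩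
  obtain ⟨S, -, h⟩ := exists_faceGap_eq B σ x
  rw [h, sub_nonneg, ← x.2.2]
  exact Finset.sum_le_univ_sum_of_nonneg x.2.1

lemma mem_faceSet_iff (S : Finset (Fin (n + 1))) (x : TopSimplex n) :
    x ∈ faceSet n S ↔ ∑ j ∈ S, (x : Fin (n + 1) → ℝ) j = 1 := by
  have h := Finset.sum_add_sum_compl S (x : Fin (n + 1) → ℝ)
  rw [show ∑ j, x j = 1 from x.2.2] at h
  have h' := Finset.sum_eq_zero_iff_of_nonneg (s := Sᶜ) (f := (x : Fin (n + 1) → ℝ))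
    fun j _ => x.2.1 j
  simp only [Finset.mem_compl] at h'
  rw [faceSet, Set.mem_ofPred_eq, ← h']
  constructor <;> intro <;> linarith

lemma faceGap_eq_zero_iff (σ : SingularSimplex X n) (x : TopSimplex n) :
    faceGap B σ x = 0 ↔ ∃ S ∈ facesIn B σ, x ∈ faceSet n S := by
  constructor
  · intro h
    obtain ⟨S, hS, hSx⟩ := exists_faceGap_eq B σ x
    exact ⟨S, hS, (mem_faceSet_iff S x).2 (by linarith)⟩
  · rintro ⟨S, hS, hx⟩
    have h := faceGap_le B hS x
    rw [(mem_faceSet_iff S x).1 hx, sub_self] at h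
    exact le_antisymm h (faceGap_mem_unitInterval B σ x).1

lemma sum_coface (i : Fin (n + 2)) (x : TopSimplex n) (S : Finset (Fin (n + 1)))
    (T : Finset (Fin (n + 2))) (hST : ∀ k, i.succAbove k ∈ T ↔ k ∈ S) :
    ∑ j ∈ T, (coface i x : Fin (n + 2) → ℝ) j = ∑ k ∈ S, (x : Fin (n + 1) → ℝ) k := by
  change ∑ j ∈ T, ∑ k : Fin (n + 1), (if i.succAbove k = j then (x : Fin (n + 1) → ℝ) k else 0) = _
  rw [Finset.sum_comm]
  simp [hST, Finset.sum_ite_mem]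

lemma coface_surjOn_face (i : Fin (n + 2)) (y : TopSimplex (n + 1))
    (hy : (y : Fin (n + 2) → ℝ) i = 0) : ∃ x, coface i x = y := by
  have hsum : ∑ j, y j = 1 := y.2.2
  rw [Fin.sum_univ_succAbove _ i, hy, zero_add] at hsum
  refine ⟨⟨fun k => y.1 (i.succAbove k), fun k => y.2.1 _, hsum⟩, Subtype.ext (funext fun j => ?_)⟩
  change (∑ k : Fin (n + 1), if i.succAbove k = j then y.1 (i.succAbove k) else 0) = y.1 j
  rcases Fin.eq_self_or_eq_succAbove i j with rfl | ⟨k, rfl⟩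
  · simp only [Fin.succAbove_ne, if_false, Finset.sum_const_zero]
    exact hy.symm
  · simp

lemma faceGap_coface (σ : SingularSimplex X (n + 1)) (i : Fin (n + 2)) (x : TopSimplex n) :
    faceGap B (σ.comp (coface i)) x = faceGap B σ (coface i x) := by
  classical
  refine le_antisymm ?_ ?_
  · obtain ⟨T, hT, h⟩ := exists_faceGap_eq B σ (coface i x)
    have hST : ∀ k, i.succAbove k ∈ T ↔ k ∈ Finset.univ.filter (i.succAbove · ∈ T) := by simp
    rw [h, sum_coface i x _ T hST]
    refine faceGap_le B (fun y hy => hT (coface i y) ?_) x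
    rw [mem_faceSet_iff] at hy ⊢
    rw [sum_coface i y _ T hST, hy]
  · obtain ⟨S, hS, h⟩ := exists_faceGap_eq B (σ.comp (coface i)) x
    have hST : ∀ k, i.succAbove k ∈ S.image i.succAbove ↔ k ∈ S := by simp
    rw [h, ← sum_coface i x S _ hST]
    refine faceGap_le B (fun y hy => ?_) _
    obtain ⟨y, rfl⟩ := coface_surjOn_face i y (hy i (by simp [Fin.succAbove_ne]))
    rw [mem_faceSet_iff, sum_coface i y S _ hST, ← mem_faceSet_iff] at hy
    exact hS y hy

end FaceGap

/-- Push every simplex off `B`, except along the faces which it maps to `B`. -/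
def pushHomotopy {X : Type*} [TopologicalSpace X] (B : Set X) (G : C(X × unitInterval, X))
    (hG : ∀ x, G (x, 0) = x) : NaturalHomotopy X where
  toFun σ :=
    { toFun := fun p => G (σ p.1, p.2 * ⟨faceGap B σ p.1, faceGap_mem_unitInterval B σ p.1⟩)
      continuous_toFun := by
        have := continuous_faceGap B σ
        fun_prop }
  start σ x := by simp [hG]
  face σ i x t := by simp [faceGap_coface]

section Push

variable {X : Type*} [TopologicalSpace X] {B : Set X} {G : C(X × unitInterval, X)}
  (hG : ∀ x, G (x, 0) = x)

lemma pushHomotopy_mem {n : ℕ} (σ : SingularSimplex X n) (hσ : Set.range ⇑σ ⊆ B)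
    (p : TopSimplex n × unitInterval) : (pushHomotopy B G hG).toFun σ p ∈ B := by
  have h0 : faceGap B σ p.1 = 0 := (faceGap_eq_zero_iff B σ p.1).2
    ⟨Finset.univ, fun x _ => hσ ⟨x, rfl⟩, fun j hj => absurd (Finset.mem_univ j) hj⟩
  have h : (⟨faceGap B σ p.1, faceGap_mem_unitInterval B σ p.1⟩ : unitInterval) = 0 :=
    Subtype.ext h0
  change G (σ p.1, p.2 * ⟨faceGap B σ p.1, _⟩) ∈ B
  rw [h, mul_zero, hG]
  exact hσ ⟨p.1, rfl⟩

lemma admissible_endSimplex_pushHomotopy (hGB : ∀ x t, G (x, t) ∈ B ↔ t = 0 ∧ x ∈ B) {n : ℕ}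
    (σ : SingularSimplex X n) : Admissible B ((pushHomotopy B G hG).endSimplex σ) := by
  refine ⟨facesIn B σ, Set.ext fun x => ?_⟩
  change G (σ x, 1 * ⟨faceGap B σ x, _⟩) ∈ B ↔ _
  rw [hGB, one_mul, Subtype.ext_iff]
  change faceGap B σ x = 0 ∧ _ ↔ _
  simp only [faceGap_eq_zero_iff, Set.mem_iUnion, exists_prop]
  exact ⟨fun h => h.1, fun ⟨S, hS, hx⟩ => ⟨⟨S, hS, hx⟩, hS x hx⟩⟩

end Push

/-! ### Collapsing the boundary -/

lemma collapseMap_mem_collapsedBoundary {X : Type*} [TopologicalSpace X] (bd : Set X) (x : X) :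
    collapseMap X bd x ∈ collapsedBoundary X bd ↔ x ∈ bd := by
  refine ⟨?_, fun hx => ⟨x, hx, rfl⟩⟩
  rintro ⟨y, hy, hxy⟩
  let p : Collapse X bd → Prop := Quot.lift (· ∈ bd) (by
    rintro a b (rfl | ⟨ha, hb, -⟩)
    · rfl
    · simp [ha, hb])
  exact (congrArg p hxy).mp hy

/-- Every relative cycle can be replaced by a marked cycle which is not longer. -/
lemma exists_idealRepresents {X : Type*} [TopologicalSpace X] {bd : Set X} {n : ℕ}
    {ζ z : SingularChain ℝ X n} (hM : IsCptMfdBdry X bd n ζ) (hz : z ∈ relativeCycles ℝ X bd n)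
    (hzζ : z - ζ ∈ relativeBoundaries ℝ X bd n) :
    ∃ z', IdealRepresents X bd n ζ z' ∧ l1Norm z' ≤ l1Norm z := by
  have := hM.compact
  obtain ⟨G, hG, hGbd⟩ := hM.collar.exists_push hM.bd_closed
  set H := pushHomotopy bd G hG
  set q := collapseMap X bd
  have hH : ∀ {n : ℕ} (σ : SingularSimplex X n), Set.range ⇑σ ⊆ bd → ∀ p, H.toFun σ p ∈ bd :=
    fun σ hσ p => pushHomotopy_mem hG σ hσ p
  have hq : Set.MapsTo q bd (collapsedBoundary X bd) := Set.mapsTo_image _ _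
  have hadm : pushChain ℝ q n (H.endMap n z) ∈
      admissibleChains ℝ (Collapse X bd) (collapsedBoundary X bd) n := by
    clear hz hzζ
    induction z using Finsupp.induction_linear with
    | zero => simp
    | add c d hc hd => rw [map_add, map_add]; exact add_mem hc hd
    | single σ r =>
      rw [H.endMap_single, pushChain_single, ← Finsupp.smul_single_one]
      refine Submodule.smul_mem _ _ (Submodule.subset_span ⟨_, ?_, rfl⟩)
      have hpre : q ⁻¹' collapsedBoundary X bd = bd :=
        Set.ext (collapseMap_mem_collapsedBoundary bd)
      rw [Admissible, ContinuousMap.coe_comp, Set.preimage_comp, hpre]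
      exact admissible_endSimplex_pushHomotopy hG hGbd σ
  refine ⟨pushChain ℝ q n (H.endMap n z), ⟨?_, ?_⟩,
    (l1Norm_mapDomain_le _ _).trans (l1Norm_mapDomain_le _ _)⟩
  · cases n with
    | zero => exact hadm
    | succ n =>
      refine ⟨hadm, ?_⟩
      change boundary ℝ (Collapse X bd) n _ ∈ chainsIn ℝ _ _ n
      rw [boundary_pushChain, H.boundary_endMap]
      exact pushChain_mem_chainsIn q hq (H.endMap_mem_chainsIn hH hz)
  · rw [idealFundamentalRep, ← map_sub, ← sub_add_sub_cancel _ z ζ]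
    exact pushChain_mem_relativeBoundaries q hq
      (add_mem (H.endMap_sub_mem_relativeBoundaries hH hz) hzζ)

/-- For every compact connected oriented manifold `M` with boundary, the ideal simplicial
volume is bounded above by the classical (relative) simplicial volume: `‖M‖_I ≤ ‖M‖`. -/
theorem idealSimplicialVolume_le_simplicialVolume {X : Type*} [TopologicalSpace X]
    (bd : Set X) (n : ℕ) (ζ : SingularChain ℝ X n) (hM : IsCptMfdBdry X bd n ζ) :
    idealSimplicialVolume X bd n ζ ≤ simplicialVolume X bd n ζ := by
  refine le_csInf ⟨_, ζ, hM.fund.1, by simp, rfl⟩ ?_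
  rintro _ ⟨z, hz, hzζ, rfl⟩
  obtain ⟨z', hz', hle⟩ := exists_idealRepresents hM hz hzζ
  have hbdd : BddBelow {r | ∃ c, IdealRepresents X bd n ζ c ∧ r = l1Norm c} :=
    ⟨0, by rintro _ ⟨c, -, rfl⟩; exact l1Norm_nonneg c⟩
  exact (csInf_le hbdd ⟨z', hz', rfl⟩).trans hle
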